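/- (Theorem 2 of the paper.) Let n ≥ 1 and m ≥ 1, let f : (Fin n → Bool) → Bool be a feedback function for an n-stage Fibonacci FSR, and let G : (Fin m → Bool) → (Fin m → Bool) be an m-stage Galois FSR transition map. If every output sequence of the Fibonacci FSR is an output sequence of the Galois FSR (i.e. for every x₀ : Fin n → Bool there exists z₀ : Fin m → Bool with outG G z₀ = outF f x₀), then m ≥ n. In particular, for a Fibonacci FSR with n stages there does not exist any equivalent Galois FSR with fewer than n stages. -/

import Mathlib

/-- The Fibonacci transition map `F_f` of an `n`-stage FSR with feedback function `f`:
`(F_f x) i = x (i+1)` when `(i : ℕ) + 1 < n`, and `(F_f x) i = f x` when `(i : ℕ) + 1 = n`. -/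
def fibStep (n : ℕ) (f : (Fin n → Bool) → Bool) (x : Fin n → Bool) : Fin n → Bool :=
  fun i => if h : (i : ℕ) + 1 < n then x ⟨(i : ℕ) + 1, h⟩ else f x

/-- The output sequence of the `n`-stage Fibonacci FSR with feedback `f` from initial state `x₀`. -/
def outF (n : ℕ) (hn : 0 < n) (f : (Fin n → Bool) → Bool) (x₀ : Fin n → Bool) (t : ℕ) : Bool :=
  (fibStep n f)^[t] x₀ ⟨0, hn⟩

/-- The output sequence of an `n`-stage (Galois) FSR with transition map `G` from initial state `z₀`. -/
def outG (n : ℕ) (hn : 0 < n) (G : (Fin n → Bool) → (Fin n → Bool)) (z₀ : Fin n → Bool) (t : ℕ) : Bool :=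
  (G^[t] z₀) ⟨0, hn⟩

/-- Iterating the Fibonacci step `t < n` times brings stage `t` to the output. -/
theorem fibStep_iterate_apply (n : ℕ) (f : (Fin n → Bool) → Bool) (x : Fin n → Bool) (t i : ℕ)
    (h : i + t < n) : (fibStep n f)^[t] x ⟨i, by lia⟩ = x ⟨i + t, h⟩ := by
  induction t generalizing i with
  | zero => rfl
  | succ t ih =>
    rw [Function.iterate_succ_apply', fibStep, dif_pos (show i + 1 < n by lia),
      ih (i + 1) (by lia)]
    congr 2
    lia

/-- The first `n` outputs of an `n`-stage Fibonacci FSR are its initial state. -/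
theorem outF_eq_apply (n : ℕ) (hn : 0 < n) (f : (Fin n → Bool) → Bool) (x : Fin n → Bool)
    (i : Fin n) : outF n hn f x i = x i := by
  have h := fibStep_iterate_apply n f x i 0 (by lia)
  simpa only [zero_add, outF] using h

/-- Distinct initial states of a Fibonacci FSR have distinct output sequences. -/
theorem outF_injective (n : ℕ) (hn : 0 < n) (f : (Fin n → Bool) → Bool) :
    Function.Injective (outF n hn f) := fun x y hxy => by
  ext1 i
  rw [← outF_eq_apply n hn f x, hxy, outF_eq_apply]

/-- Theorem 2: if every output sequence of an `n`-stage Fibonacci FSR is an output sequence of an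
`m`-stage Galois FSR, then `m ≥ n`; a Fibonacci FSR has no equivalent Galois FSR with fewer stages. -/
theorem no_smaller_equivalent_galois (n m : ℕ) (hn : 1 ≤ n) (hm : 1 ≤ m)
    (f : (Fin n → Bool) → Bool) (G : (Fin m → Bool) → (Fin m → Bool))
    (h : ∀ x₀ : Fin n → Bool, ∃ z₀ : Fin m → Bool, outG m hm G z₀ = outF n hn f x₀) :
    n ≤ m := by
  choose z hz using h
  have hinj : Function.Injective z := fun x y hxy => outF_injective n hn f <| by
    rw [← hz x, ← hz y, hxy]
  have hcard := Fintype.card_le_of_injective z hinj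
  simp only [Fintype.card_fun, Fintype.card_bool, Fintype.card_fin] at hcard
  exact (Nat.pow_le_pow_iff_right one_lt_two).mp hcard
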